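/- Let π be a finite projective plane of order q with q ≥ 2. Then the number of embeddings of the complete bipartite graph K_{q,q} into π equals 2 · (q!)² · C(q²+q+1, 2), where C(q²+q+1, 2) denotes the binomial coefficient. -/

import Mathlib

/-- `φ : V → P` is an embedding of the graph `G` into the projective plane with
points `P` and lines `L`. -/
def IsGraphEmbedding {V : Type*} (G : SimpleGraph V) (P L : Type*) [Membership P L]
    (φ : V → P) : Prop :=
  Function.Injective φ ∧
    ∀ e₁ ∈ G.edgeSet, ∀ e₂ ∈ G.edgeSet, ∀ ℓ : L,
      (∀ v ∈ e₁, φ v ∈ ℓ) → (∀ v ∈ e₂, φ v ∈ ℓ) → e₁ = e₂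

open Configuration Configuration.ProjectivePlane in
/-- Removing from a line its intersection with another line leaves as many points as the order. -/
lemma card_mem_and_notMem {P L : Type*} [Fintype P] [Fintype L] [Membership P L]
    [ProjectivePlane P L] {l m : L} (h : l ≠ m) :
    Nat.card {p : P // p ∈ l ∧ p ∉ m} = order P L := by
  obtain ⟨hxl, hxm⟩ := HasPoints.mkPoint_ax (P := P) h
  set x : P := HasPoints.mkPoint h
  have key : {p : P | p ∈ l ∧ p ∉ m} = {p : P | p ∈ l} \ {x} := by
    ext p
    simp only [Set.mem_ofPred_eq, Set.mem_sdiff, Set.mem_singleton_iff]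
    refine and_congr_right fun hpl => not_congr ⟨fun hpm => ?_, fun hp => hp ▸ hxm⟩
    exact (Nondegenerate.eq_or_eq hpl hxl hpm hxm).resolve_right h
  have hcard : Set.ncard {p : P | p ∈ l} = order P L + 1 := pointCount_eq P l
  change Set.ncard {p : P | p ∈ l ∧ p ∉ m} = order P L
  rw [key, Set.ncard_sdiff_singleton_of_mem (s := {p : P | p ∈ l}) hxl, hcard,
    Nat.add_sub_cancel]

/-- A map out of the vertices of a complete bipartite graph is an embedding if and only if it is
injective and no line carries the images of two different edges. -/
lemma isGraphEmbedding_completeBipartiteGraph_iff {U V P L : Type*} [Membership P L]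
    (φ : U ⊕ V → P) :
    IsGraphEmbedding (completeBipartiteGraph U V) P L φ ↔
      Function.Injective φ ∧ ∀ (i i' : U) (j j' : V) (l : L),
        φ (.inl i) ∈ l → φ (.inr j) ∈ l → φ (.inl i') ∈ l → φ (.inr j') ∈ l →
          i = i' ∧ j = j' := by
  have edge : ∀ e ∈ (completeBipartiteGraph U V).edgeSet,
      ∃ i j, e = s(Sum.inl i, Sum.inr j) := by
    intro e
    induction e using Sym2.ind with
    | _ x y =>
      rcases x with i | j <;> rcases y with i' | j' <;> simp
  refine and_congr_right fun _ => ⟨fun h i i' j j' l h₁ h₂ h₃ h₄ => ?_,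
    fun h e he e' he' l hl hl' => ?_⟩
  · have := h s(.inl i, .inr j) (by simp) s(.inl i', .inr j') (by simp) l
      (by simp [h₁, h₂]) (by simp [h₃, h₄])
    simpa using this
  · obtain ⟨i, j, rfl⟩ := edge e he
    obtain ⟨i', j', rfl⟩ := edge e' he'
    obtain ⟨rfl, rfl⟩ := h i i' j j' l (hl _ (by simp)) (hl _ (by simp)) (hl' _ (by simp))
      (hl' _ (by simp))
    rfl

open Configuration Configuration.ProjectivePlane in
/-- If the lines joining a point of `α` to a point of `β` are pairwise distinct, where `β` has as
many points as the order of the plane, then the points of `α` lie on a line that avoids `β`. -/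
lemma exists_line_of_join_injective {U V P L : Type*} [Nontrivial U] [Fintype P] [Fintype L]
    [Membership P L] [ProjectivePlane P L] {α : U → P} {β : V → P}
    (hV : Nat.card V = order P L) (hα : Function.Injective α) (hαβ : ∀ i j, α i ≠ β j)
    (h : ∀ (i i' : U) (j j' : V) (l : L),
      α i ∈ l → β j ∈ l → α i' ∈ l → β j' ∈ l → i = i' ∧ j = j') :
    ∃ l : L, (∀ i, α i ∈ l) ∧ ∀ j, β j ∉ l := by
  obtain ⟨a, b, hab⟩ := exists_pair_ne U
  have join : ∀ i, a ≠ i → ∃ l : L, α a ∈ l ∧ α i ∈ l ∧ ∀ j, β j ∉ l := fun i hi => by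
    obtain ⟨h₁, h₂⟩ := HasLines.mkLine_ax (L := L) (hα.ne hi)
    exact ⟨_, h₁, h₂, fun j hj => hi (h a i j j _ h₁ hj h₂ hj).1⟩
  obtain ⟨l, hal, hbl, hl⟩ := join b hab
  refine ⟨l, fun i => ?_, hl⟩
  by_cases hi : a = i
  · exact hi ▸ hal
  obtain ⟨m, ham, him, hm⟩ := join i hi
  suffices l = m from this ▸ him
  by_contra hlm
  have : Finite V := Nat.finite_of_card_ne_zero
    (hV ▸ (zero_lt_one.trans (one_lt_order P L)).ne')
  have hj := fun j => HasLines.mkLine_ax (L := L) (hαβ a j)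
  let g : Option (Option V) → {l : L // α a ∈ l}
    | none => ⟨l, hal⟩
    | some none => ⟨m, ham⟩
    | some (some j) => ⟨HasLines.mkLine (hαβ a j), (hj j).1⟩
  have hg : Function.Injective g := by
    rintro (_ | _ | j) (_ | _ | j') hjj <;> simp only [g, Subtype.mk.injEq] at hjj
    · rfl
    · exact (hlm hjj).elim
    · exact (hl j' (hjj ▸ (hj j').2)).elim
    · exact (hlm hjj.symm).elim
    · rfl
    · exact (hm j' (hjj ▸ (hj j').2)).elim
    · exact (hl j (hjj ▸ (hj j).2)).elim
    · exact (hm j (hjj ▸ (hj j).2)).elim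
    · rw [(h a a j j' _ (hj j).1 (hj j).2 (hj j).1 (hjj ▸ (hj j').2)).2]
  have hle := Nat.card_le_card_of_injective g hg
  have hcard : Nat.card {l : L // α a ∈ l} = order P L + 1 := lineCount_eq L (α a)
  rw [Finite.card_option, Finite.card_option, hV, hcard] at hle
  omega

open Configuration Configuration.ProjectivePlane in
/-- The embeddings of `K_{q,q}` into a plane of order `q` are the maps sending the two vertex
classes injectively into two distinct lines, away from their intersection point. -/
lemma isGraphEmbedding_completeBipartiteGraph_iff_exists_lines {U V P L : Type*}
    [Nontrivial U] [Nontrivial V] [Fintype P] [Fintype L] [Membership P L] [ProjectivePlane P L]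
    (hU : Nat.card U = order P L) (hV : Nat.card V = order P L) (φ : U ⊕ V → P) :
    IsGraphEmbedding (completeBipartiteGraph U V) P L φ ↔
      Function.Injective (φ ∘ .inl) ∧ Function.Injective (φ ∘ .inr) ∧ ∃ l m : L,
        (∀ i, φ (.inl i) ∈ l ∧ φ (.inl i) ∉ m) ∧ ∀ j, φ (.inr j) ∈ m ∧ φ (.inr j) ∉ l := by
  rw [isGraphEmbedding_completeBipartiteGraph_iff]
  constructor
  · rintro ⟨hφ, h⟩
    have hl := hφ.comp Sum.inl_injective
    have hr := hφ.comp Sum.inr_injective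
    obtain ⟨l, hl₁, hl₂⟩ := exists_line_of_join_injective hV hl
      (fun i j => hφ.ne Sum.inl_ne_inr) h
    obtain ⟨m, hm₁, hm₂⟩ := exists_line_of_join_injective hU hr
      (fun i j => hφ.ne Sum.inr_ne_inl)
      (fun j j' i i' k h₁ h₂ h₃ h₄ => (h i i' j j' k h₂ h₁ h₄ h₃).symm)
    exact ⟨hl, hr, l, m, fun i => ⟨hl₁ i, hm₂ i⟩, fun j => ⟨hm₁ j, hl₂ j⟩⟩
  · rintro ⟨hl, hr, l, m, hα, hβ⟩
    refine ⟨?_, fun i i' j j' k h₁ h₂ h₃ h₄ => ⟨?_, ?_⟩⟩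
    · rintro (i | j) (i' | j') hij
      · exact congrArg _ (hl hij)
      · exact ((hβ j').2 (hij ▸ (hα i).1)).elim
      · exact ((hβ j).2 (hij ▸ (hα i').1)).elim
      · exact congrArg _ (hr hij)
    · refine hl ((Nondegenerate.eq_or_eq h₁ h₃ (hα i).1 (hα i').1).resolve_right ?_)
      rintro rfl
      exact (hβ j).2 h₂
    · refine hr ((Nondegenerate.eq_or_eq h₂ h₄ (hβ j).1 (hβ j').1).resolve_right ?_)
      rintro rfl
      exact (hα i).2 h₁

/-- The number of embeddings of `K_{q,q}` into a finite projective plane of order `q ≥ 2`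
equals `2 · (q!)² · C(q²+q+1, 2)`. -/
theorem count_Kqq_embeddings {P L : Type*} [Fintype P] [Fintype L]
    [Membership P L] [Configuration.ProjectivePlane P L] (q : ℕ) (hq2 : 2 ≤ q)
    (hq : Configuration.ProjectivePlane.order P L = q) :
    Set.ncard {φ : Fin q ⊕ Fin q → P |
        IsGraphEmbedding (completeBipartiteGraph (Fin q) (Fin q)) P L φ} =
      2 * q.factorial ^ 2 * (q ^ 2 + q + 1).choose 2 := by
  classical
  have : Nontrivial (Fin q) := Fin.nontrivial_iff_two_le.mpr hq2
  have hqc : Nat.card (Fin q) = Configuration.ProjectivePlane.order P L := by simp [hq]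
  let T := Σ lm : {lm : L × L // lm.1 ≠ lm.2},
    (Fin q ↪ {p : P // p ∈ lm.1.1 ∧ p ∉ lm.1.2}) × (Fin q ↪ {p : P // p ∈ lm.1.2 ∧ p ∉ lm.1.1})
  let F : T → Fin q ⊕ Fin q → P := fun t => Sum.elim (fun i => t.2.1 i) (fun j => t.2.2 j)
  have line_eq : ∀ (f : Fin q → P) (l l' : L), Function.Injective f → (∀ i, f i ∈ l) →
      (∀ i, f i ∈ l') → l = l' := fun f l l' hf hl hl' => by
    obtain ⟨a, b, hab⟩ := exists_pair_ne (Fin q)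
    exact (Configuration.Nondegenerate.eq_or_eq (hl a) (hl b) (hl' a) (hl' b)).resolve_left
      (hf.ne hab)
  have hF : Function.Injective F := by
    rintro ⟨⟨⟨l, m⟩, hlm⟩, f, g⟩ ⟨⟨⟨l', m'⟩, hlm'⟩, f', g'⟩ h
    have hf : ∀ i, (f i : P) = f' i := fun i => congrFun h (.inl i)
    have hg : ∀ j, (g j : P) = g' j := fun j => congrFun h (.inr j)
    obtain rfl : l = l' := line_eq (fun i => f i) l l' (Subtype.val_injective.comp f.injective)
      (fun i => (f i).2.1) (fun i => by rw [hf]; exact (f' i).2.1)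
    obtain rfl : m = m' := line_eq (fun j => g j) m m' (Subtype.val_injective.comp g.injective)
      (fun j => (g j).2.1) (fun j => by rw [hg]; exact (g' j).2.1)
    obtain rfl : f = f' := DFunLike.ext _ _ fun i => Subtype.ext (hf i)
    obtain rfl : g = g' := DFunLike.ext _ _ fun j => Subtype.ext (hg j)
    rfl
  have hrange : {φ : Fin q ⊕ Fin q → P |
      IsGraphEmbedding (completeBipartiteGraph (Fin q) (Fin q)) P L φ} = Set.range F := by
    ext φ
    rw [Set.mem_ofPred_eq, isGraphEmbedding_completeBipartiteGraph_iff_exists_lines hqc hqc]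
    constructor
    · rintro ⟨hl, hr, l, m, hα, hβ⟩
      obtain ⟨a⟩ : Nonempty (Fin q) := inferInstance
      refine ⟨⟨⟨(l, m), ?_⟩, ⟨fun i => ⟨_, hα i⟩, fun i i' h => hl (congrArg Subtype.val h)⟩,
        ⟨fun j => ⟨_, hβ j⟩, fun j j' h => hr (congrArg Subtype.val h)⟩⟩, ?_⟩
      · rintro (rfl : l = m)
        exact (hα a).2 (hα a).1
      · funext x
        cases x <;> rfl
    · rintro ⟨⟨⟨⟨l, m⟩, hlm⟩, f, g⟩, rfl⟩
      exact ⟨Subtype.val_injective.comp f.injective, Subtype.val_injective.comp g.injective,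
        l, m, fun i => (f i).2, fun j => (g j).2⟩
  have emb : ∀ l m : L, l ≠ m →
      Fintype.card (Fin q ↪ {p : P // p ∈ l ∧ p ∉ m}) = q.factorial := fun l m h => by
    rw [Fintype.card_embedding_eq, ← Nat.card_eq_fintype_card, card_mem_and_notMem h, hq,
      Fintype.card_fin, Nat.descFactorial_self]
  have pairs : Fintype.card {lm : L × L // lm.1 ≠ lm.2} = 2 * (q ^ 2 + q + 1).choose 2 := by
    have hL : Fintype.card L = q ^ 2 + q + 1 := hq ▸ Configuration.ProjectivePlane.card_lines P L
    have : Fintype.card {lm : L × L // lm.1 ≠ lm.2} = (Finset.univ : Finset L).offDiag.card := by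
      rw [Fintype.card_subtype]
      congr 1
      ext; simp
    rw [this, Finset.offDiag_card, Finset.card_univ, hL, Nat.choose_two_right,
      Nat.mul_div_cancel' (Nat.even_mul_pred_self _).two_dvd, Nat.mul_sub_one]
  rw [hrange, ← Set.image_univ, Set.ncard_image_of_injective _ hF, Set.ncard_univ,
    Nat.card_eq_fintype_card, Fintype.card_sigma]
  simp_rw [Fintype.card_prod]
  rw [Finset.sum_congr rfl fun lm _ => by rw [emb _ _ lm.2, emb _ _ lm.2.symm],
    Finset.sum_const, Finset.card_univ, pairs, smul_eq_mul]
  ring
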